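/- Let H be a right quaternionic Hilbert space and T ∈ B(H). The right spectrum is contained in the S-spectrum: σ(T) ⊆ σ_S(T). Equivalently, for λ ∈ ℍ, if Δ_λ(T) is invertible in B(H) then T_λ is invertible in B_ℝ(H). -/

import Mathlib

open MulOpposite Filter Topology Quaternion

noncomputable section

/- We model a right quaternionic Hilbert space as a real Banach space `H` equipped with a
right `ℍ`-module structure (encoded as a `ℍ[ℝ]ᵐᵒᵖ`-module, so that `x·q` is `op q • x`),
compatible with the real structure (`hreal`) and with the norm (`hnorm`). -/

variable {H : Type*} [NormedAddCommGroup H] [NormedSpace ℝ H] [Module ℍ[ℝ]ᵐᵒᵖ H]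

/-- The operator `T_λ : x ↦ x·λ - T x`. -/
def opTlam (T : H →L[ℝ] H) (l : ℍ[ℝ]) : H → H := fun x => op l • x - T x

/-- The operator `Δ_λ(T) = T² - 2 Re(λ) T + |λ|² I`. -/
def opDelta (T : H →L[ℝ] H) (l : ℍ[ℝ]) : H → H :=
  fun x => T (T x) - (2 * l.re) • T x + (‖l‖ ^ 2) • x

/-- A map is right `ℍ`-linear when it commutes with the right quaternionic scalar action
(together with additivity, which is automatic for the bundled maps we use). -/
def IsRightQLinear (S : H → H) : Prop := ∀ (q : ℍ[ℝ]) (x : H), S (op q • x) = op q • S x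

/-- Invertibility in `B_ℝ(H)`: existence of a two-sided inverse which is a bounded
`ℝ`-linear operator. -/
def InvertibleInBR (f : H → H) : Prop :=
  ∃ S : H →L[ℝ] H, (∀ x, S (f x) = x) ∧ (∀ x, f (S x) = x)

/-- Invertibility in `B(H)`: existence of a two-sided inverse which is a bounded
right `ℍ`-linear operator. -/
def InvertibleInBH (f : H → H) : Prop :=
  ∃ S : H →L[ℝ] H, IsRightQLinear (S : H → H) ∧ (∀ x, S (f x) = x) ∧ (∀ x, f (S x) = x)

/-- An operator is bounded below if `‖f x‖ ≥ k ‖x‖` for some `k > 0`. -/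
def BoundedBelowOp (f : H → H) : Prop := ∃ k > 0, ∀ x : H, k * ‖x‖ ≤ ‖f x‖

/-- The right spectrum `σ(T)`. -/
def rightSpectrum (T : H →L[ℝ] H) : Set ℍ[ℝ] := {l | ¬ InvertibleInBR (opTlam T l)}

/-- The S-spectrum `σ_S(T)`. -/
def sSpectrum (T : H →L[ℝ] H) : Set ℍ[ℝ] := {l | ¬ InvertibleInBH (opDelta T l)}

/-- The point spectrum `σ_p(T)`. -/
def pointSpectrum (T : H →L[ℝ] H) : Set ℍ[ℝ] := {l | ∃ x : H, x ≠ 0 ∧ opTlam T l x = 0}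

/-- The point S-spectrum `σ_{S,p}(T)`. -/
def sPointSpectrum (T : H →L[ℝ] H) : Set ℍ[ℝ] := {l | ∃ x : H, x ≠ 0 ∧ opDelta T l x = 0}

/-- The residual spectrum `σ_r(T)`. -/
def residualSpectrum (T : H →L[ℝ] H) : Set ℍ[ℝ] :=
  {l | l ∉ pointSpectrum T ∧ ¬ Dense (Set.range (opTlam T l))}

/-- The residual S-spectrum `σ_{S,r}(T)`. -/
def sResidualSpectrum (T : H →L[ℝ] H) : Set ℍ[ℝ] :=
  {l | l ∉ sPointSpectrum T ∧ ¬ Dense (Set.range (opDelta T l))}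

/-- The continuous spectrum `σ_c(T)`. -/
def continuousSpectrum (T : H →L[ℝ] H) : Set ℍ[ℝ] :=
  {l | l ∉ pointSpectrum T ∧ l ∉ residualSpectrum T ∧ ¬ BoundedBelowOp (opTlam T l)}

/-- The continuous S-spectrum `σ_{S,c}(T)`. -/
def sContinuousSpectrum (T : H →L[ℝ] H) : Set ℍ[ℝ] :=
  {l | l ∉ sPointSpectrum T ∧ l ∉ sResidualSpectrum T ∧ ¬ BoundedBelowOp (opDelta T l)}

/-- Right multiplication by a quaternion, as a bounded real-linear operator. -/
def rightMulCLM (hreal : ∀ (r : ℝ) (x : H), op ((r : ℍ[ℝ])) • x = r • x)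
    (hnorm : ∀ (x : H) (q : ℍ[ℝ]), ‖op q • x‖ = ‖x‖ * ‖q‖) (q : ℍ[ℝ]) : H →L[ℝ] H :=
  LinearMap.mkContinuous
    { toFun := fun x => op q • x
      map_add' := fun x y => smul_add _ x y
      map_smul' := fun r x => by
        rw [RingHom.id_apply, ← hreal, ← hreal, smul_smul, smul_smul, ← op_mul, ← op_mul,
          Quaternion.coe_commutes] }
    ‖q‖ fun x => by
      rw [mul_comm]
      exact (hnorm x q).le

/-- The factorization `T_λ ∘ T_{λ̄} = Δ_λ(T)`. -/
theorem opTlam_opTlam_star {T : H →L[ℝ] H} (hT : IsRightQLinear (T : H → H))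
    (hreal : ∀ (r : ℝ) (x : H), op ((r : ℍ[ℝ])) • x = r • x) (l : ℍ[ℝ]) (x : H) :
    opTlam T l (opTlam T (star l) x) = opDelta T l x := by
  have hmul : op l • op (star l) • x = (‖l‖ ^ 2) • x := by
    rw [smul_smul, ← op_mul, Quaternion.star_mul_self, hreal, Quaternion.normSq_eq_norm_mul_self,
      sq]
  have hadd : op l • T x + op (star l) • T x = (2 * l.re) • T x := by
    rw [← add_smul, ← op_add, Quaternion.self_add_star', hreal]
  simp only [opTlam, opDelta, smul_sub, map_sub, hmul, hT (star l) x, ← hadd]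
  abel

/-- The factorization `T_{λ̄} ∘ T_λ = Δ_λ(T)`. -/
theorem opTlam_star_opTlam {T : H →L[ℝ] H} (hT : IsRightQLinear (T : H → H))
    (hreal : ∀ (r : ℝ) (x : H), op ((r : ℍ[ℝ])) • x = r • x) (l : ℍ[ℝ]) (x : H) :
    opTlam T (star l) (opTlam T l x) = opDelta T l x := by
  have h := opTlam_opTlam_star hT hreal (star l) x
  rw [star_star] at h
  rw [h]
  simp [opDelta]

/-- `σ(T) ⊆ σ_S(T)`; equivalently, invertibility of `Δ_λ(T)` in `B(H)` implies
invertibility of `T_λ` in `B_ℝ(H)`. -/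
theorem rightSpectrum_subset_sSpectrum [CompleteSpace H] (T : H →L[ℝ] H)
    (hT : IsRightQLinear (T : H → H))
    (hreal : ∀ (r : ℝ) (x : H), op ((r : ℍ[ℝ])) • x = r • x)
    (hnorm : ∀ (x : H) (q : ℍ[ℝ]), ‖op q • x‖ = ‖x‖ * ‖q‖) :
    rightSpectrum T ⊆ sSpectrum T ∧
      ∀ l : ℍ[ℝ], InvertibleInBH (opDelta T l) → InvertibleInBR (opTlam T l) := by
  have hinvertible : ∀ l : ℍ[ℝ], InvertibleInBH (opDelta T l) → InvertibleInBR (opTlam T l) := by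
    rintro l ⟨S, -, hleft, hright⟩
    have hinv : ∀ x, opTlam T l (opTlam T (star l) (S x)) = x := fun x => by
      rw [opTlam_opTlam_star hT hreal, hright]
    have hinj : Function.Injective (opTlam T l) :=
      Function.LeftInverse.injective (g := fun x => S (opTlam T (star l) x)) fun x => by
        simp only [opTlam_star_opTlam hT hreal, hleft]
    exact ⟨(rightMulCLM hreal hnorm (star l) - T).comp S, fun x => hinj (hinv _), hinv⟩
  exact ⟨fun l hl h => hl (hinvertible l h), hinvertible⟩
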